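/- There exists a nonzero homogeneous polynomial P ∈ ℝ[x₀,x₁,x₂] of degree 12, squarefree over ℂ, such that ℝZ(P) = {[x] ∈ ℙ²(ℝ) : P(x) = 0} is finite and |ℝZ(P)| = 45. -/

import Mathlib

open MvPolynomial

/-- The real projective zero set of a homogeneous polynomial in three variables. -/
noncomputable def RZ (P : MvPolynomial (Fin 3) ℝ) : Set (Projectivization ℝ (Fin 3 → ℝ)) :=
  {x | MvPolynomial.eval x.rep P = 0}

/-- The invariant form of degree twelve, in terms of elementary symmetric functions of the
squares of the coordinates and of `d = √5 (X - Y) (Y - Z) (Z - X)`. -/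
def PE {R : Type*} [CommRing R] (e1 e2 e3 d : R) : R :=
  -1485*e3*d + 945*e3^2 + 1350*e2^3 - 297*e1*e2*d + 9090*e1*e2*e3 - 1125*e1^2*e2^2
    + 88*e1^3*d - 2290*e1^3*e3 + 200*e1^4*e2

/-- The same form in terms of `X = x ^ 2` and so on. -/
def PX {R : Type*} [CommRing R] (s X Y Z : R) : R :=
  PE (X + Y + Z) (X*Y + Y*Z + Z*X) (X*Y*Z) (s*((X - Y)*(Y - Z)*(Z - X)))

/-- The icosahedral form of degree twelve. -/
def PG {R : Type*} [CommRing R] (s x y z : R) : R := PX s (x^2) (y^2) (z^2)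

/-- The square root of the discriminant, up to the factor `x y z`. -/
noncomputable def NE (e1 e2 e3 d : ℝ) : ℝ :=
  -145/2*e3*d + 837/2*e3^2 - 225*e2^3 + 15/2*e1*e2*d + 135*e1*e2*e3 + 235/2*e1^2*e2^2
    - e1^3*d - 44*e1^3*e3 - 19*e1^4*e2 + e1^6

/-- Product of four of the mirrors. -/
noncomputable def QM (s X Y Z : ℝ) : ℝ :=
  X^2 + (7 + 3*s)/2*Y^2 + (7 - 3*s)/2*Z^2 - (3 + s)*X*Y - (3 - s)*X*Z - 2*Y*Z

theorem map_PG {R S : Type*} [CommRing R] [CommRing S] (φ : R →+* S) (s x y z : R) :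
    φ (PG s x y z) = PG (φ s) (φ x) (φ y) (φ z) := by
  simp only [PG, PX, PE, map_add, map_sub, map_mul, map_pow, map_neg, map_ofNat]

theorem id_one (e1 e2 e3 d : ℝ)
    (hd : d^2 = 5*(e1^2*e2^2 - 4*e2^3 - 4*e1^3*e3 + 18*e1*e2*e3 - 27*e3^2))
    (hP : PE e1 e2 e3 d = 0) :
    ∃ u : ℝ, e1^3*(e3*NE e1 e2 e3 d^2) + u^2*(u + 4/27*e1^3)^2*
      (16875/4096*u^2 + 97/64*u*e1^3 + 9/64*(e1^3)^2) = 0 := by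
  refine ⟨(d + 11*e3 - e1*e2)/2, ?_⟩
  obtain ⟨u, hu⟩ : ∃ u : ℝ, u = (d + 11*e3 - e1*e2)/2 := ⟨_, rfl⟩
  obtain ⟨w, hw⟩ : ∃ w : ℝ, w = PE e1 e2 e3 d / 360 := ⟨_, rfl⟩
  have key : e1^3*(e3*NE e1 e2 e3 d^2) + u^2*(u + 4/27*e1^3)^2*
      (16875/4096*u^2 + 97/64*u*e1^3 + 9/64*(e1^3)^2) =
      w*((-5/9)*u*(e1^3)^3 - 5765/864*u^2*(e1^3)^2 - 1475/64*u^3*e1^3 - 16875/1024*u^4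
        + w*(5/16*(e1^3)^2 + 2125/96*u*e1^3 - 5625/256*u^2) - 625/64*w^2) := by
    subst hu hw
    unfold NE PE
    linear_combination ((1/20)*e1^12 + (-891/640)*e1^10*e2 + (-6489/1024)*e1^9*e3 + (-13/128)*e1^9*d +
      (201989/20480)*e1^8*e2^2 + (51771/256)*e1^7*e2*e3 + (115/64)*e1^7*e2*d +
      (-251975/8192)*e1^6*e2^3 + (-4148753/16384)*e1^6*e3^2 + (-3289/2048)*e1^6*e3*d +
      (4403/4096)*e1^6*d^2 + (-36332175/32768)*e1^5*e2^2*e3 + (-96375/8192)*e1^5*e2^2*d +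
      (13921875/262144)*e1^4*e2^4 + (-5057325/16384)*e1^4*e2*e3^2 + (538575/4096)*e1^4*e2*e3*d +
      (-44685/8192)*e1^4*e2*d^2 + (98404875/65536)*e1^3*e2^3*e3 + (244125/8192)*e1^3*e2^3*d +
      (13415645/32768)*e1^3*e3^3 + (-3661875/8192)*e1^3*e3^2*d + (-492165/32768)*e1^3*e3*d^2 +
      (2763/8192)*e1^3*d^3 + (-1771875/32768)*e1^2*e2^5 + (598483125/131072)*e1^2*e2^2*e3^2 +
      (-1596375/4096)*e1^2*e2^2*e3*d + (682425/131072)*e1^2*e2^2*d^2 + (9028125/16384)*e1*e2^4*e3 +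
      (-50625/2048)*e1*e2^4*d + (243759375/65536)*e1*e2*e3^3 + (-1366875/8192)*e1*e2*e3^2*d +
      (1805625/65536)*e1*e2*e3*d^2 + (-10125/8192)*e1*e2*d^3 + (421875/16384)*e2^6 +
      (11390625/32768)*e2^3*e3^2 + (84375/32768)*e2^3*d^2 + (307546875/262144)*e3^4 +
      (2278125/131072)*e3^2*d^2 + (16875/262144)*d^4) * hd
  rw [hu] at key
  rw [key, hw, hP]
  ring

theorem id_two (s X Y Z : ℝ) (hs : s^2 = 5) :
    NE (X + Y + Z) (X*Y + Y*Z + Z*X) (X*Y*Z) (s*((X - Y)*(Y - Z)*(Z - X))) =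
      QM s X Y Z * QM s Y Z X * QM s Z X Y := by
  unfold NE QM
  linear_combination ((9/4)*X^6 + (-9/4)*X^5*Y*s + (-33/4)*X^5*Y + (9/4)*X^5*Z*s + (-33/4)*X^5*Z + (39/8)*X^4*Y^2*s +
      (97/8)*X^4*Y^2 + (9/2)*X^4*Y*Z + (-39/8)*X^4*Z^2*s + (97/8)*X^4*Z^2 + (-11)*X^3*Y^3 +
      (-17/2)*X^3*Y^2*Z*s + (11/2)*X^3*Y^2*Z + (17/2)*X^3*Y*Z^2*s + (11/2)*X^3*Y*Z^2 + (-11)*X^3*Z^3 +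
      (-39/8)*X^2*Y^4*s + (97/8)*X^2*Y^4 + (17/2)*X^2*Y^3*Z*s + (11/2)*X^2*Y^3*Z + (-87/2)*X^2*Y^2*Z^2 +
      (-17/2)*X^2*Y*Z^3*s + (11/2)*X^2*Y*Z^3 + (39/8)*X^2*Z^4*s + (97/8)*X^2*Z^4 + (9/4)*X*Y^5*s +
      (-33/4)*X*Y^5 + (9/2)*X*Y^4*Z + (-17/2)*X*Y^3*Z^2*s + (11/2)*X*Y^3*Z^2 + (17/2)*X*Y^2*Z^3*s +
      (11/2)*X*Y^2*Z^3 + (9/2)*X*Y*Z^4 + (-9/4)*X*Z^5*s + (-33/4)*X*Z^5 + (9/4)*Y^6 + (-9/4)*Y^5*Z*s +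
      (-33/4)*Y^5*Z + (39/8)*Y^4*Z^2*s + (97/8)*Y^4*Z^2 + (-11)*Y^3*Z^3 + (-39/8)*Y^2*Z^4*s +
      (97/8)*Y^2*Z^4 + (9/4)*Y*Z^5*s + (-33/4)*Y*Z^5 + (9/4)*Z^6) * hs

theorem id_quart (s x y z : ℝ) (hs : s^2 = 5) :
    16*QM s (x^2) (y^2) (z^2) =
      (2*x + (1 + s)*y + (s - 1)*z)*(2*x + (1 + s)*y - (s - 1)*z)*
      ((2*x - (1 + s)*y + (s - 1)*z)*(2*x - (1 + s)*y - (s - 1)*z)) := by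
  unfold QM
  linear_combination (8*x^2*y^2 + 8*x^2*z^2 + (-1)*y^4*s^2 + (-4)*y^4*s + (-11)*y^4 + 2*y^2*z^2*s^2 + 6*y^2*z^2 +
      (-1)*z^4*s^2 + 4*z^4*s + (-11)*z^4) * hs

theorem zero_mirror (s x y z : ℝ) (hs : s^2 = 5) (h0 : x ≠ 0 ∨ y ≠ 0 ∨ z ≠ 0)
    (hP : PG s x y z = 0) :
    x^2*y^2*z^2 = 0 ∨ QM s (x^2) (y^2) (z^2) = 0 ∨ QM s (y^2) (z^2) (x^2) = 0 ∨
      QM s (z^2) (x^2) (y^2) = 0 := by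
  have he1 : 0 < x^2 + y^2 + z^2 := by
    rcases h0 with h | h | h <;> positivity
  obtain ⟨u, hu⟩ := id_one (x^2 + y^2 + z^2) (x^2*y^2 + y^2*z^2 + z^2*x^2) (x^2*y^2*z^2)
    (s*((x^2 - y^2)*(y^2 - z^2)*(z^2 - x^2)))
    (by linear_combination ((x^2 - y^2)*(y^2 - z^2)*(z^2 - x^2))^2 * hs) hP
  rw [id_two _ _ _ _ hs] at hu
  set e := (x^2 + y^2 + z^2)^3 with he
  set n := QM s (x^2) (y^2) (z^2) * QM s (y^2) (z^2) (x^2) * QM s (z^2) (x^2) (y^2) with hn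
  have he0 : 0 < e := by positivity
  have hr : 0 ≤ 16875/4096*u^2 + 97/64*u*e + 9/64*e^2 := by
    nlinarith [sq_nonneg (e + 97/18*u), sq_nonneg u]
  have h1 : 0 ≤ u^2*(u + 4/27*e)^2*(16875/4096*u^2 + 97/64*u*e + 9/64*e^2) := by positivity
  have h2 : 0 ≤ x^2*y^2*z^2*n^2 := by positivity
  have h3 : x^2*y^2*z^2*n^2 = 0 := by
    by_contra hne
    have : 0 < e*(x^2*y^2*z^2*n^2) := mul_pos he0 (lt_of_le_of_ne h2 (Ne.symm hne))
    linarith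
  rcases mul_eq_zero.mp h3 with h | h
  · exact Or.inl h
  · have h4 : n = 0 := by simpa using h
    rw [hn] at h4
    rcases mul_eq_zero.mp h4 with h | h
    · rcases mul_eq_zero.mp h with h | h
      · exact Or.inr (Or.inl h)
      · exact Or.inr (Or.inr (Or.inl h))
    · exact Or.inr (Or.inr (Or.inr h))

theorem zero_base (s y z : ℝ) (hs : s^2 = 5) (hs0 : 0 < s) (hP : PG s 0 y z = 0) :
    y = 0 ∨ z = 0 ∨ 2*y = (3 + s)*z ∨ 2*y = -(3 + s)*z := by
  have hs1 : s < 2.238 := by nlinarith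
  by_cases hy : y = 0
  · exact Or.inl hy
  by_cases hz : z = 0
  · exact Or.inr (Or.inl hz)
  have key : y^2*z^2*(y^2 - (7 + 3*s)/2*z^2)^2*
      ((200 - 88*s)*(y^2)^2 + (105*s - 245)*y^2*z^2 + (80 - 32*s)*(z^2)^2) = 0 := by
    have h := hP
    unfold PG PX PE at h
    linear_combination h - ((-264)*y^8*z^4 + 198*y^6*z^6*s + 789*y^6*z^6 + (-945/4)*y^4*z^8*s + (-2589/4)*y^4*z^8 +
      72*y^2*z^10*s + 156*y^2*z^10) * hs
  have hq : 0 < (200 - 88*s)*(y^2)^2 + (105*s - 245)*y^2*z^2 + (80 - 32*s)*(z^2)^2 := by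
    have hz2 : 0 < (z^2)^2 := by positivity
    have h4 : 4*(200 - 88*s)*((200 - 88*s)*(y^2)^2 + (105*s - 245)*y^2*z^2 + (80 - 32*s)*(z^2)^2)
        = (2*(200 - 88*s)*y^2 + (105*s - 245)*z^2)^2 + (5170 - 2310*s)*(z^2)^2 := by
      linear_combination (239*(z^2)^2) * hs
    have h5 : 0 < (5170 - 2310*s)*(z^2)^2 := mul_pos (by linarith) hz2
    have h6 : 0 < 4*(200 - 88*s) := by linarith
    by_contra hneg
    push Not at hneg
    nlinarith [mul_nonneg h6.le (neg_nonneg.mpr hneg),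
      sq_nonneg (2*(200 - 88*s)*y^2 + (105*s - 245)*z^2)]
  have h7 : (y^2 - (7 + 3*s)/2*z^2)^2 = 0 := by
    rcases mul_eq_zero.mp key with h | h
    · rcases mul_eq_zero.mp h with h | h
      · exact absurd h (by positivity)
      · exact h
    · exact absurd h hq.ne'
  have h8 : y^2 - (7 + 3*s)/2*z^2 = 0 := by simpa using h7
  have h9 : (2*y - (3 + s)*z)*(2*y + (3 + s)*z) = 0 := by
    linear_combination 4*h8 - z^2*hs
  rcases mul_eq_zero.mp h9 with h | h
  · exact Or.inr (Or.inr (Or.inl (by linarith)))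
  · exact Or.inr (Or.inr (Or.inr (by linarith)))

theorem id_rot (s p q : ℝ) (hs : s^2 = 5) :
    PG s ((1 + s)*p + (s - 1)*q) (-((s - 1)*p) - 2*q) ((1 + s)*q - 2*p) =
      PG s 0 (4*p) (4*q) := by
  have hA : ((1 + s)*p + (s - 1)*q)^2 = (6 + 2*s)*p^2 + 8*p*q + (6 - 2*s)*q^2 := by
    linear_combination (p^2 + 2*p*q + q^2) * hs
  have hB : (-((s - 1)*p) - 2*q)^2 = (6 - 2*s)*p^2 + 4*(s - 1)*p*q + 4*q^2 := by
    linear_combination (p^2) * hs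
  have hC : ((1 + s)*q - 2*p)^2 = 4*p^2 - 4*(1 + s)*p*q + (6 + 2*s)*q^2 := by
    linear_combination (q^2) * hs
  have h2 : ((6 + 2*s)*p^2 + 8*p*q + (6 - 2*s)*q^2)*((6 - 2*s)*p^2 + 4*(s - 1)*p*q + 4*q^2)
      + ((6 - 2*s)*p^2 + 4*(s - 1)*p*q + 4*q^2)*(4*p^2 - 4*(1 + s)*p*q + (6 + 2*s)*q^2)
      + (4*p^2 - 4*(1 + s)*p*q + (6 + 2*s)*q^2)*((6 + 2*s)*p^2 + 8*p*q + (6 - 2*s)*q^2) =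
      64*p^4 + (-32)*p^3*q*s + 32*p^3*q + 64*p^2*q^2 + 32*p*q^3*s + 32*p*q^3 + 64*q^4 := by
    linear_combination ((-4)*p^4 + 8*p^3*q + (-12)*p^2*q^2 + 8*p*q^3 + (-4)*q^4) * hs
  have h3 : ((6 + 2*s)*p^2 + 8*p*q + (6 - 2*s)*q^2)*((6 - 2*s)*p^2 + 4*(s - 1)*p*q + 4*q^2)
      * (4*p^2 - 4*(1 + s)*p*q + (6 + 2*s)*q^2) =
      64*p^6 + (-64)*p^5*q*s + 192*p^5*q + (-160)*p^4*q^2*s + 32*p^4*q^2 + (-256)*p^3*q^3 +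
      160*p^2*q^4*s + 32*p^2*q^4 + 64*p*q^5*s + 192*p*q^5 + 64*q^6 := by
    linear_combination ((-16)*p^6 + 16*p^5*q*s + 48*p^5*q + (-40)*p^4*q^2*s + (-40)*p^4*q^2 + (-64)*p^3*q^3 +
      40*p^2*q^4*s + (-40)*p^2*q^4 + (-16)*p*q^5*s + 48*p*q^5 + (-16)*q^6) * hs
  have h4 : s*((((6 + 2*s)*p^2 + 8*p*q + (6 - 2*s)*q^2)
        - ((6 - 2*s)*p^2 + 4*(s - 1)*p*q + 4*q^2))
      * (((6 - 2*s)*p^2 + 4*(s - 1)*p*q + 4*q^2) - (4*p^2 - 4*(1 + s)*p*q + (6 + 2*s)*q^2))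
      * ((4*p^2 - 4*(1 + s)*p*q + (6 + 2*s)*q^2)
        - ((6 + 2*s)*p^2 + 8*p*q + (6 - 2*s)*q^2))) =
      320*p^6 + 192*p^5*q*s + (-1600)*p^5*q + (-2336)*p^4*q^2*s + (-2400)*p^4*q^2 + 3840*p^3*q^3 +
      2336*p^2*q^4*s + (-2400)*p^2*q^4 + (-192)*p*q^5*s + (-1600)*p*q^5 + 320*q^6 := by
    linear_combination (16*p^6*s^2 + 64*p^6 + (-48)*p^5*q*s^2 + 48*p^5*q*s + (-320)*p^5*q + (-120)*p^4*q^2*s^2 +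
      (-408)*p^4*q^2*s + (-480)*p^4*q^2 + 320*p^3*q^3*s^2 + 768*p^3*q^3 + (-120)*p^2*q^4*s^2 +
      408*p^2*q^4*s + (-480)*p^2*q^4 + (-48)*p*q^5*s^2 + (-48)*p*q^5*s + (-320)*p*q^5 + 16*q^6*s^2 +
      64*q^6) * hs
  unfold PG PX
  rw [hA, hB, hC, h2, h3, h4]
  unfold PE
  linear_combination (319684608*p^10*q^2 + (-44236800)*p^9*q^3*s + 365101056*p^9*q^3 + (-796262400)*p^8*q^4 +
      132710400*p^7*q^5*s + (-365101056)*p^7*q^5 + 953155584*p^6*q^6 + (-132710400)*p^5*q^7*s +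
      (-365101056)*p^5*q^7 + (-796262400)*p^4*q^8 + 44236800*p^3*q^9*s + 365101056*p^3*q^9 +
      319684608*p^2*q^10) * hs

/-- The 45 points, with coordinates in `ℤ[√5]`. -/
def cyc3 (p : ℤ√5 × ℤ√5 × ℤ√5) : List (ℤ√5 × ℤ√5 × ℤ√5) :=
  [p, (p.2.1, p.2.2, p.1), (p.2.2, p.1, p.2.1)]

/-- Sign changes of the last two coordinates. -/
def sgn4 (p : ℤ√5 × ℤ√5 × ℤ√5) : List (ℤ√5 × ℤ√5 × ℤ√5) :=
  [p, (p.1, -p.2.1, p.2.2), (p.1, p.2.1, -p.2.2), (p.1, -p.2.1, -p.2.2)]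

/-- The list of the 45 points. -/
def LP : List (ℤ√5 × ℤ√5 × ℤ√5) :=
  cyc3 (1, 0, 0) ++ cyc3 (0, ⟨3, 1⟩, 2) ++ cyc3 (0, ⟨3, 1⟩, -2) ++
  (sgn4 (⟨1, 1⟩, ⟨-1, 1⟩, 2)).flatMap cyc3 ++
  (sgn4 (⟨3, 3⟩, ⟨3, 1⟩, 2)).flatMap cyc3 ++
  (sgn4 (⟨5, 1⟩, ⟨-1, 1⟩, ⟨4, 2⟩)).flatMap cyc3

theorem LP_length : LP.length = 45 := by decide +kernel

theorem LP_cyc : ∀ p ∈ LP, ((p.2.1, p.2.2, p.1) : ℤ√5 × ℤ√5 × ℤ√5) ∈ LP := by decide +kernel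

theorem LP_neg : ∀ p ∈ LP, ((p.1, p.2.1, -p.2.2) : ℤ√5 × ℤ√5 × ℤ√5) ∈ LP ∨
    ((-p.1, -p.2.1, p.2.2) : ℤ√5 × ℤ√5 × ℤ√5) ∈ LP := by decide +kernel

theorem LP_zero : ∀ p ∈ LP, PG (⟨0, 1⟩ : ℤ√5) p.1 p.2.1 p.2.2 = 0 := by decide +kernel

theorem LP_nz : ∀ p ∈ LP, p.1 ≠ 0 ∨ p.2.1 ≠ 0 ∨ p.2.2 ≠ 0 := by decide +kernel

theorem LP_cross : LP.Pairwise (fun p q => p.1*q.2.1 - p.2.1*q.1 ≠ 0 ∨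
    p.2.1*q.2.2 - p.2.2*q.2.1 ≠ 0 ∨ p.1*q.2.2 - p.2.2*q.1 ≠ 0) := by decide +kernel

/-- The embedding of `ℤ[√5]` into the reals. -/
noncomputable def ev : ℤ√5 →+* ℝ := Zsqrtd.toReal (d := 5) (by norm_num)

theorem ev_mk (a b : ℤ) : ev ⟨a, b⟩ = a + b * √5 := by
  simp [ev, Zsqrtd.toReal]

theorem ev_inj : Function.Injective ev := by
  apply Zsqrtd.toReal_injective
  intro n h
  have h1 : n.natAbs * n.natAbs = 5 := by
    have := congrArg Int.natAbs h
    rw [Int.natAbs_mul] at this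
    simpa using this.symm
  have h2 : n.natAbs < 3 := by nlinarith
  interval_cases n.natAbs <;> omega

/-- Being proportional to one of the 45 points. -/
def Good (x y z : ℝ) : Prop :=
  ∃ p ∈ LP, ∃ c : ℝ, x = c * ev p.1 ∧ y = c * ev p.2.1 ∧ z = c * ev p.2.2

theorem Good.cyc {x y z : ℝ} (h : Good x y z) : Good y z x := by
  obtain ⟨p, hp, c, h1, h2, h3⟩ := h
  exact ⟨_, LP_cyc p hp, c, h2, h3, h1⟩

theorem Good.neg {x y z : ℝ} (h : Good x y (-z)) : Good x y z := by
  obtain ⟨p, hp, c, h1, h2, h3⟩ := h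
  rcases LP_neg p hp with h | h
  · exact ⟨_, h, c, h1, h2, by rw [map_neg]; linarith⟩
  · exact ⟨_, h, -c, by rw [map_neg]; linarith, by rw [map_neg]; linarith, by linarith⟩

theorem Good.neg2 {x y z : ℝ} (h : Good x (-y) z) : Good x y z :=
  h.cyc.cyc.neg.cyc

theorem sqrt5_sq : (√5 : ℝ)^2 = 5 := Real.sq_sqrt (by norm_num)

theorem sqrt5_pos : (0 : ℝ) < √5 := by positivity

theorem good_base (y z : ℝ) (hP : PG √5 0 y z = 0) : Good 0 y z := by
  rcases zero_base √5 y z sqrt5_sq sqrt5_pos hP with h | h | h | h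
  · refine ⟨(0, 0, 1), by decide +kernel, z, by simp, by simp [h], by simp⟩
  · refine ⟨(0, 1, 0), by decide +kernel, y, by simp, by simp, by simp [h]⟩
  · refine ⟨(0, ⟨3, 1⟩, ⟨2, 0⟩), by decide +kernel, z/2, by simp, ?_, ?_⟩
    · rw [ev_mk]; push_cast; linarith
    · rw [ev_mk]; push_cast; linarith
  · refine ⟨(0, ⟨3, 1⟩, ⟨-2, 0⟩), by decide +kernel, -z/2, by simp, ?_, ?_⟩
    · rw [ev_mk]; push_cast; linarith
    · rw [ev_mk]; push_cast; linarith

theorem good_mirror (a b c : ℝ) (h : 2*a + (1 + √5)*b + (√5 - 1)*c = 0)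
    (hP : PG √5 a b c = 0) : Good a b c := by
  have hs := sqrt5_sq
  have hs0 := sqrt5_pos
  generalize hsd : (√5 : ℝ) = s at *
  obtain ⟨p, hp⟩ : ∃ p : ℝ, p = ((1 + s)*a - (s - 1)*b - 2*c)/16 := ⟨_, rfl⟩
  obtain ⟨q, hq⟩ : ∃ q : ℝ, q = ((s - 1)*a - 2*b + (1 + s)*c)/16 := ⟨_, rfl⟩
  have ha : a = (1 + s)*p + (s - 1)*q := by
    rw [hp, hq]; linear_combination 2/16*h + ((-2)*a + 1*b + (-1)*c)/16*hs
  have hb : b = -((s - 1)*p) - 2*q := by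
    rw [hp, hq]; linear_combination (1 + s)/16*h + (1*a + (-2)*b + (-1)*c)/16*hs
  have hc : c = (1 + s)*q - 2*p := by
    rw [hp, hq]; linear_combination (s - 1)/16*h + ((-1)*a + (-1)*b + (-2)*c)/16*hs
  rw [ha, hb, hc, id_rot s p q hs] at hP
  rcases zero_base s (4*p) (4*q) hs hs0 hP with h | h | h | h
  · have h0 : p = 0 := by linarith
    rw [ha, hb, hc, h0]
    refine ⟨(⟨-1, 1⟩, ⟨-2, 0⟩, ⟨1, 1⟩), by decide +kernel, q, ?_, ?_, ?_⟩ <;>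
      rw [ev_mk, hsd] <;> push_cast <;> ring
  · have h0 : q = 0 := by linarith
    rw [ha, hb, hc, h0]
    refine ⟨(⟨1, 1⟩, ⟨1, -1⟩, ⟨-2, 0⟩), by decide +kernel, p, ?_, ?_, ?_⟩ <;>
      rw [ev_mk, hsd] <;> push_cast <;> ring
  · have h0 : p = (3 + s)/2*q := by linarith
    rw [ha, hb, hc, h0]
    refine ⟨(⟨3, 3⟩, ⟨-3, -1⟩, ⟨-2, 0⟩), by decide +kernel, q, ?_, ?_, ?_⟩ <;>
      rw [ev_mk, hsd] <;> push_cast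
    · linear_combination q/2*hs
    · linear_combination -q/2*hs
    · ring
  · have h0 : p = -(3 + s)/2*q := by linarith
    rw [ha, hb, hc, h0]
    refine ⟨(⟨5, 1⟩, ⟨1, -1⟩, ⟨-4, -2⟩), by decide +kernel, -q, ?_, ?_, ?_⟩ <;>
      rw [ev_mk, hsd] <;> push_cast
    · linear_combination -q/2*hs
    · linear_combination q/2*hs
    · ring

theorem PG_cyc (s x y z : ℝ) : PG s y z x = PG s x y z := by
  unfold PG PX PE; ring

theorem PG_neg (s x y z : ℝ) : PG s x y (-z) = PG s x y z := by
  simp [PG]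

theorem PG_neg2 (s x y z : ℝ) : PG s x (-y) z = PG s x y z := by
  simp [PG]

theorem good_quart (a b c : ℝ) (h : QM √5 (a^2) (b^2) (c^2) = 0)
    (hP : PG √5 a b c = 0) : Good a b c := by
  have h1 := id_quart √5 a b c sqrt5_sq
  rw [h, mul_zero] at h1
  rcases mul_eq_zero.mp h1.symm with h2 | h2
  · rcases mul_eq_zero.mp h2 with h3 | h3
    · exact good_mirror a b c h3 hP
    · exact (good_mirror a b (-c) (by linarith) (by rw [PG_neg]; exact hP)).neg
  · rcases mul_eq_zero.mp h2 with h3 | h3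
    · exact (good_mirror a (-b) c (by linarith) (by rw [PG_neg2]; exact hP)).neg2
    · exact (good_mirror a (-b) (-c) (by linarith)
        (by rw [PG_neg, PG_neg2]; exact hP)).neg.neg2

theorem good_of_zero (x y z : ℝ) (h0 : x ≠ 0 ∨ y ≠ 0 ∨ z ≠ 0) (hP : PG √5 x y z = 0) :
    Good x y z := by
  have hP1 : PG √5 y z x = 0 := by rw [PG_cyc]; exact hP
  have hP2 : PG √5 z x y = 0 := by rw [PG_cyc]; exact hP1
  rcases zero_mirror √5 x y z sqrt5_sq h0 hP with h | h | h | h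
  · have h' : (x = 0 ∨ y = 0) ∨ z = 0 := by simpa using h
    rcases h' with (h | h) | h
    · subst h; exact good_base y z hP
    · subst h; exact (good_base z x hP1).cyc.cyc
    · subst h; exact (good_base x y hP2).cyc
  · exact good_quart x y z h hP
  · exact (good_quart y z x h hP1).cyc.cyc
  · exact (good_quart z x y h hP2).cyc

/-- The polynomial. -/
noncomputable def PP : MvPolynomial (Fin 3) ℝ := PG (C √5) (X 0) (X 1) (X 2)

theorem PP_eval (v : Fin 3 → ℝ) : MvPolynomial.eval v PP = PG √5 (v 0) (v 1) (v 2) := by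
  unfold PP
  rw [map_PG]
  simp

theorem PP_ne : PP ≠ 0 := by
  intro h
  have h1 := PP_eval ![1, 1, 1]
  rw [h] at h1
  simp [PG, PX, PE] at h1
  norm_num at h1

theorem PP_hom : PP.IsHomogeneous 12 := by
  have hX : ∀ i : Fin 3, ((X i : MvPolynomial (Fin 3) ℝ)^2).IsHomogeneous 2 := fun i =>
    isHomogeneous_X_pow i 2
  have key : ∀ e1 e2 e3 d : MvPolynomial (Fin 3) ℝ, e1.IsHomogeneous 2 → e2.IsHomogeneous 4 →
      e3.IsHomogeneous 6 → d.IsHomogeneous 6 → (PE e1 e2 e3 d).IsHomogeneous 12 := by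
    intro e1 e2 e3 d h1 h2 h3 hd
    have e : PE e1 e2 e3 d = C (-1485)*(e3*d) + C 945*e3^2 + C 1350*e2^3 + C (-297)*(e1*e2*d)
        + C 9090*(e1*e2*e3) + C (-1125)*(e1^2*e2^2)
        + C 88*(e1^3*d) + C (-2290)*(e1^3*e3) + C 200*(e1^4*e2) := by
      simp only [PE, map_neg, map_ofNat]; ring
    rw [e]
    refine IsHomogeneous.add (IsHomogeneous.add (IsHomogeneous.add (IsHomogeneous.add
      (IsHomogeneous.add (IsHomogeneous.add (IsHomogeneous.add (IsHomogeneous.add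
      ?_ ?_) ?_) ?_) ?_) ?_) ?_) ?_) ?_ <;> apply IsHomogeneous.C_mul
    · exact h3.mul hd
    · exact h3.pow 2
    · exact h2.pow 3
    · exact (h1.mul h2).mul hd
    · exact (h1.mul h2).mul h3
    · exact (h1.pow 2).mul (h2.pow 2)
    · exact (h1.pow 3).mul hd
    · exact (h1.pow 3).mul h3
    · exact (h1.pow 4).mul h2
  unfold PP PG PX
  apply key
  · exact ((hX 0).add (hX 1)).add (hX 2)
  · exact (((hX 0).mul (hX 1)).add ((hX 1).mul (hX 2))).add ((hX 2).mul (hX 0))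
  · exact ((hX 0).mul (hX 1)).mul (hX 2)
  · exact ((((hX 0).sub (hX 1)).mul ((hX 1).sub (hX 2))).mul ((hX 2).sub (hX 0))).C_mul _

/-- The restriction to a complex line, as a polynomial in the cube of the parameter. -/
def qq {R : Type*} [CommRing R] (k T : R) : R :=
  14850*T^4 + (-14256*k - 71280)*T^3 + (20790*k - 228690)*T^2 + (-14256*k - 451440)*T
    + (1485*k + 945)

/-- The derivative of `qq`. -/
def dqq {R : Type*} [CommRing R] (k T : R) : R :=
  4*14850*T^3 + 3*(-14256*k - 71280)*T^2 + 2*(20790*k - 228690)*T + (-14256*k - 451440)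

theorem bezout_qq {R : Type*} [CommRing R] (k T : R) (hk : k^2 = -135) :
    ∃ a b : R, a * qq k T + b * dqq k T =
      59340868036853760 := by
  refine ⟨1262088300*T^2*k + (-17292823900)*T^2 + 7885764128*T*k + 184425128800*T + (-24327480320)*k +
      15481123840,
      (-315522075)*T^3*k + 4323205975*T^3 + (-2630383976)*T^2*k + (-61517044600)*T^2 + 11500927680*T*k +
      (-7318772160)*T + 3356883456*k + (-106301309440), ?_⟩
  unfold qq dqq
  linear_combination ((-4498082701200)*T^5 + 13196216355300*T^4 + (-103979693180880)*T^3 + (-244173432886020)*T^2 +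
      334144908266400*T + (-83982038823936)) * hk

theorem restrict_eq {R : Type*} [CommRing R] (s W X : R) (hW : W^2 = -1 - W) :
    PG s (X + 1) (X + W) (X - 1 - W) = qq (s*(-3 - 6*W)) (X^3) := by
  have h1 : (X + 1)^2 + (X + W)^2 + (X - 1 - W)^2 = 3*X^2 := by
    linear_combination 2*hW
  have h2 : (X + 1)^2*(X + W)^2 + (X + W)^2*(X - 1 - W)^2 + (X - 1 - W)^2*(X + 1)^2 =
      3*X*(X^3 - 2) := by
    linear_combination (6*X + 1*W^2 + 1*W + 1)*hW
  have h3 : (X + 1)^2*(X + W)^2*(X - 1 - W)^2 = (X^3 + 1)^2 := by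
    linear_combination ((-2)*X^4 + (-2)*X^3 + 1*X^2*W^2 + 1*X^2*W + 1*X^2 + 2*X*W^2 + 2*X*W
      + 1*W^2 + 1*W + (-1))*hW
  have h4 : ((X + 1)^2 - (X + W)^2)*((X + W)^2 - (X - 1 - W)^2)*((X - 1 - W)^2 - (X + 1)^2) =
      (-3 - 6*W)*(8*X^3 - 1) := by
    linear_combination (16*X^3*W + 8*X^3 + (-4)*X*W^3 + (-6)*X*W^2 + 6*X*W + 4*X + 2*W^3
      + 3*W^2 + (-5)*W + (-3))*hW
  unfold PG PX
  rw [h1, h2, h3, h4]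
  unfold PE qq
  ring

theorem exists_omega : ∃ w : ℂ, w^2 = -1 - w := by
  obtain ⟨r, hr⟩ : ∃ r : ℂ, r^2 = -3 := ⟨Complex.I * (√3 : ℝ), by
    rw [mul_pow, Complex.I_sq, ← Complex.ofReal_pow, Real.sq_sqrt (by norm_num)]; norm_num⟩
  exact ⟨(-1 + r)/2, by linear_combination 1/4*hr⟩

theorem qq_poly_natDegree (k : ℂ) :
    (qq (Polynomial.C k) ((Polynomial.X : Polynomial ℂ)^3)).natDegree = 12 := by
  have e : qq (Polynomial.C k) ((Polynomial.X : Polynomial ℂ)^3) =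
      Polynomial.C 14850*Polynomial.X^12 + Polynomial.C (-14256*k - 71280)*Polynomial.X^9
      + Polynomial.C (20790*k - 228690)*Polynomial.X^6
      + Polynomial.C (-14256*k - 451440)*Polynomial.X^3 + Polynomial.C (1485*k + 945) := by
    simp only [qq, map_add, map_sub, map_mul, map_neg, map_ofNat]; ring
  rw [e]
  compute_degree!

theorem qq_poly_squarefree (k : ℂ) (hk : k^2 = -135) :
    Squarefree (qq (Polynomial.C k) ((Polynomial.X : Polynomial ℂ)^3)) := by
  apply Polynomial.Separable.squarefree
  have hkC : (Polynomial.C k)^2 = (-135 : Polynomial ℂ) := by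
    rw [← map_pow, hk, map_neg, map_ofNat]
  have hder : Polynomial.derivative (qq (Polynomial.C k) ((Polynomial.X : Polynomial ℂ)^3)) =
      (Polynomial.C 3 * (Polynomial.X*Polynomial.X)) *
        dqq (Polynomial.C k) ((Polynomial.X : Polynomial ℂ)^3) := by
    have e : qq (Polynomial.C k) ((Polynomial.X : Polynomial ℂ)^3) =
      Polynomial.C 14850*Polynomial.X^12 + Polynomial.C (-14256*k - 71280)*Polynomial.X^9
      + Polynomial.C (20790*k - 228690)*Polynomial.X^6
      + Polynomial.C (-14256*k - 451440)*Polynomial.X^3 + Polynomial.C (1485*k + 945) := by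
      simp only [qq, map_add, map_sub, map_mul, map_neg, map_ofNat]; ring
    rw [e]
    simp only [Polynomial.derivative_add, Polynomial.derivative_C_mul_X_pow,
      Polynomial.derivative_C, dqq]
    simp only [map_add, map_sub, map_mul, map_neg, map_ofNat, Nat.cast_ofNat]
    ring
  rw [Polynomial.separable_def, hder]
  have unitC : ∀ c : ℂ, c ≠ 0 → IsUnit (Polynomial.C c) := fun c hc =>
    Polynomial.isUnit_C.mpr (isUnit_iff_ne_zero.mpr hc)
  have hX : IsCoprime (qq (Polynomial.C k) ((Polynomial.X : Polynomial ℂ)^3)) Polynomial.X := by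
    have hc : (1485*k + 945 : ℂ) ≠ 0 := by
      intro h
      have : k = -7/11 := by linear_combination h/1485
      rw [this] at hk
      norm_num at hk
    refine ⟨Polynomial.C (1485*k + 945)⁻¹, -Polynomial.C (1485*k + 945)⁻¹ *
      (14850*Polynomial.X^11 + (-14256*Polynomial.C k - 71280)*Polynomial.X^8
      + (20790*Polynomial.C k - 228690)*Polynomial.X^5
      + (-14256*Polynomial.C k - 451440)*Polynomial.X^2), ?_⟩
    have h1 : Polynomial.C (1485*k + 945)⁻¹ * (1485*Polynomial.C k + 945) = 1 := by
      have : (1485*Polynomial.C k + 945 : Polynomial ℂ) = Polynomial.C (1485*k + 945) := by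
        simp only [map_add, map_mul, map_ofNat]
      rw [this, ← Polynomial.C_mul, inv_mul_cancel₀ hc, Polynomial.C_1]
    unfold qq
    linear_combination h1
  have h3 : IsCoprime (qq (Polynomial.C k) ((Polynomial.X : Polynomial ℂ)^3))
      (Polynomial.C 3) := by
    exact (isCoprime_one_right.of_isCoprime_of_dvd_right
      ((unitC 3 (by norm_num)).dvd))
  have hd : IsCoprime (qq (Polynomial.C k) ((Polynomial.X : Polynomial ℂ)^3))
      (dqq (Polynomial.C k) ((Polynomial.X : Polynomial ℂ)^3)) := by
    obtain ⟨a, b, hab⟩ := bezout_qq (Polynomial.C k) ((Polynomial.X : Polynomial ℂ)^3) hkC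
    obtain ⟨L, hL⟩ : ∃ L : ℂ,
      L = 59340868036853760 := ⟨_, rfl⟩
    have hL0 : L ≠ 0 := by rw [hL]; norm_num
    have hab' : a * qq (Polynomial.C k) ((Polynomial.X : Polynomial ℂ)^3) +
        b * dqq (Polynomial.C k) ((Polynomial.X : Polynomial ℂ)^3) = Polynomial.C L := by
      rw [hab, hL, map_ofNat]
    have h1 : Polynomial.C L⁻¹ * Polynomial.C L = 1 := by
      rw [← Polynomial.C_mul, inv_mul_cancel₀ hL0, Polynomial.C_1]
    refine ⟨Polynomial.C L⁻¹ * a, Polynomial.C L⁻¹ * b, ?_⟩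
    linear_combination Polynomial.C L⁻¹ * hab' + h1
  exact (h3.mul_right (hX.mul_right hX)).mul_right hd

theorem PP_sqfree : Squarefree (MvPolynomial.map (algebraMap ℝ ℂ) PP) := by
  obtain ⟨w, hw⟩ := exists_omega
  have hmap : MvPolynomial.map (algebraMap ℝ ℂ) PP =
      PG (C ((√5 : ℝ) : ℂ)) (X 0) (X 1) (X 2) := by
    unfold PP
    rw [map_PG]
    simp
  obtain ⟨k, hkd⟩ : ∃ k : ℂ, k = ((√5 : ℝ) : ℂ)*(-3 - 6*w) := ⟨_, rfl⟩
  have hk : k^2 = -135 := by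
    have h5 : ((√5 : ℝ) : ℂ)^2 = 5 := by
      rw [← Complex.ofReal_pow, sqrt5_sq]; norm_num
    rw [hkd]
    linear_combination (-3 - 6*w)^2*h5 + 180*hw
  let l : Fin 3 → Polynomial ℂ :=
    ![Polynomial.X + 1, Polynomial.X + Polynomial.C w, Polynomial.X - 1 - Polynomial.C w]
  have hl : ∀ i, (l i).natDegree ≤ 1 := by
    intro i
    fin_cases i
    · change (Polynomial.X + 1 : Polynomial ℂ).natDegree ≤ 1
      compute_degree
    · change (Polynomial.X + Polynomial.C w : Polynomial ℂ).natDegree ≤ 1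
      compute_degree
    · change (Polynomial.X - 1 - Polynomial.C w : Polynomial ℂ).natDegree ≤ 1
      compute_degree
  have hdeg : ∀ A : MvPolynomial (Fin 3) ℂ, (aeval l A).natDegree ≤ A.totalDegree := by
    intro A
    have := MvPolynomial.aeval_natDegree_le A le_rfl l hl
    simpa using this
  have hW : (Polynomial.C w)^2 = -1 - Polynomial.C w := by
    rw [← map_pow, hw]; simp
  have hres : aeval l (MvPolynomial.map (algebraMap ℝ ℂ) PP) =
      qq (Polynomial.C k) ((Polynomial.X : Polynomial ℂ)^3) := by
    rw [hmap]
    have h1 := map_PG (aeval l : MvPolynomial (Fin 3) ℂ →ₐ[ℂ] Polynomial ℂ).toRingHom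
      (C ((√5 : ℝ) : ℂ)) (X 0) (X 1) (X 2)
    simp only [AlgHom.toRingHom_eq_coe, RingHom.coe_coe, aeval_X] at h1
    rw [h1]
    have h2 : aeval l (C ((√5 : ℝ) : ℂ)) = Polynomial.C ((√5 : ℝ) : ℂ) := by
      rw [aeval_C]; rfl
    rw [h2]
    change PG (Polynomial.C ((√5 : ℝ) : ℂ)) (Polynomial.X + 1) (Polynomial.X + Polynomial.C w)
      (Polynomial.X - 1 - Polynomial.C w) = _
    rw [restrict_eq _ _ _ hW, hkd]
    simp only [map_mul, map_sub, map_neg, map_ofNat]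
  have htot : (MvPolynomial.map (algebraMap ℝ ℂ) PP).totalDegree ≤ 12 :=
    (PP_hom.map (algebraMap ℝ ℂ)).totalDegree_le
  have hsq := qq_poly_squarefree k hk
  have hnd := qq_poly_natDegree k
  intro A hA
  obtain ⟨B, hB⟩ := hA
  rw [hB] at hres htot
  have hne : qq (Polynomial.C k) ((Polynomial.X : Polynomial ℂ)^3) ≠ 0 := hsq.ne_zero
  have hABne : A * A * B ≠ 0 := by
    intro h
    rw [h, map_zero] at hres
    exact hne hres.symm
  have hA0 : A ≠ 0 := fun h => hABne (by simp [h])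
  have hB0 : B ≠ 0 := fun h => hABne (by simp [h])
  rw [totalDegree_mul_of_isDomain (mul_ne_zero hA0 hA0) hB0,
    totalDegree_mul_of_isDomain hA0 hA0] at htot
  rw [map_mul, map_mul] at hres
  have hu : IsUnit (aeval l A) := hsq _ ⟨aeval l B, hres.symm⟩
  have hu0 : (aeval l A).natDegree = 0 := Polynomial.natDegree_eq_zero_of_isUnit hu
  have h12 : 12 ≤ B.totalDegree := by
    have h1 : (aeval l A * aeval l A * aeval l B).natDegree ≤
        (aeval l A).natDegree + (aeval l A).natDegree + (aeval l B).natDegree :=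
      (Polynomial.natDegree_mul_le).trans
        (Nat.add_le_add_right Polynomial.natDegree_mul_le _)
    rw [hres, hnd, hu0] at h1
    have := hdeg B
    omega
  have hAt : A.totalDegree = 0 := by omega
  rw [totalDegree_eq_zero_iff_eq_C] at hAt
  rw [hAt]
  apply IsUnit.map
  rw [isUnit_iff_ne_zero]
  intro h
  rw [h, map_zero] at hAt
  exact hA0 hAt

/-- The real vector of a point. -/
noncomputable def vec (p : ℤ√5 × ℤ√5 × ℤ√5) : Fin 3 → ℝ := ![ev p.1, ev p.2.1, ev p.2.2]

theorem vec_ne {p : ℤ√5 × ℤ√5 × ℤ√5} (hp : p ∈ LP) : vec p ≠ 0 := by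
  intro h
  have h0 : ev p.1 = 0 := congrFun h 0
  have h1 : ev p.2.1 = 0 := congrFun h 1
  have h2 : ev p.2.2 = 0 := congrFun h 2
  rw [map_eq_zero_iff ev ev_inj] at h0 h1 h2
  rcases LP_nz p hp with h | h | h <;> contradiction

/-- The 45 projective points. -/
noncomputable def pt (i : Fin LP.length) : Projectivization ℝ (Fin 3 → ℝ) :=
  Projectivization.mk ℝ (vec (LP.get i)) (vec_ne (LP.get_mem i))

theorem pt_cross {i j : Fin LP.length} (h : pt i = pt j) :
    (LP.get i).1*(LP.get j).2.1 - (LP.get i).2.1*(LP.get j).1 = 0 ∧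
    (LP.get i).2.1*(LP.get j).2.2 - (LP.get i).2.2*(LP.get j).2.1 = 0 ∧
    (LP.get i).1*(LP.get j).2.2 - (LP.get i).2.2*(LP.get j).1 = 0 := by
  unfold pt at h
  rw [Projectivization.mk_eq_mk_iff'] at h
  obtain ⟨a, ha⟩ := h
  have h0 : a * ev (LP.get j).1 = ev (LP.get i).1 := congrFun ha 0
  have h1 : a * ev (LP.get j).2.1 = ev (LP.get i).2.1 := congrFun ha 1
  have h2 : a * ev (LP.get j).2.2 = ev (LP.get i).2.2 := congrFun ha 2
  refine ⟨?_, ?_, ?_⟩ <;> apply ev_inj <;> rw [map_sub, map_mul, map_mul, map_zero]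
  · rw [← h0, ← h1]; ring
  · rw [← h1, ← h2]; ring
  · rw [← h0, ← h2]; ring

theorem pt_inj : Function.Injective pt := by
  have key : ∀ i j : Fin LP.length, i < j → pt i ≠ pt j := by
    intro i j hij h
    have h1 := List.pairwise_iff_get.mp LP_cross i j hij
    obtain ⟨a, b, c⟩ := pt_cross h
    rcases h1 with h1 | h1 | h1 <;> contradiction
  intro i j h
  rcases lt_trichotomy i j with hij | hij | hij
  · exact absurd h (key i j hij)
  · exact hij
  · exact absurd h.symm (key j i hij)

theorem PG_smul (s c x y z : ℝ) : PG s (c*x) (c*y) (c*z) = c^12 * PG s x y z := by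
  unfold PG PX PE; ring

theorem ev_root : ev ⟨0, 1⟩ = √5 := by rw [ev_mk]; simp

theorem RZ_eq : RZ PP = Set.range pt := by
  ext x
  constructor
  · intro hx
    have hx' : PG √5 (x.rep 0) (x.rep 1) (x.rep 2) = 0 := by
      rw [← PP_eval]; exact hx
    have hn : x.rep 0 ≠ 0 ∨ x.rep 1 ≠ 0 ∨ x.rep 2 ≠ 0 := by
      by_contra hcon
      push Not at hcon
      apply x.rep_nonzero
      ext i
      fin_cases i
      · exact hcon.1
      · exact hcon.2.1
      · exact hcon.2.2
    obtain ⟨p, hp, c, h0, h1, h2⟩ := good_of_zero _ _ _ hn hx'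
    obtain ⟨i, hi⟩ := List.get_of_mem hp
    refine ⟨i, ?_⟩
    rw [← x.mk_rep]
    unfold pt
    symm
    rw [Projectivization.mk_eq_mk_iff']
    refine ⟨c, ?_⟩
    rw [hi]
    ext j
    fin_cases j
    · exact h0.symm
    · exact h1.symm
    · exact h2.symm
  · rintro ⟨i, rfl⟩
    change MvPolynomial.eval (pt i).rep PP = 0
    obtain ⟨a, ha⟩ := Projectivization.exists_smul_eq_mk_rep ℝ (vec (LP.get i))
      (vec_ne (LP.get_mem i))
    have ha' : (a : ℝ) • vec (LP.get i) = (pt i).rep := ha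
    have h := congrArg ev (LP_zero _ (LP.get_mem i))
    rw [map_PG, map_zero, ev_root] at h
    rw [PP_eval, ← ha']
    change PG √5 ((a : ℝ) * ev (LP.get i).1) ((a : ℝ) * ev (LP.get i).2.1)
      ((a : ℝ) * ev (LP.get i).2.2) = 0
    rw [PG_smul, h, mul_zero]

theorem stmt_5 :
    ∃ P : MvPolynomial (Fin 3) ℝ, P ≠ 0 ∧ P.IsHomogeneous 12 ∧
      Squarefree (MvPolynomial.map (algebraMap ℝ ℂ) P) ∧
      (RZ P).Finite ∧ (RZ P).ncard = 45 := by
  refine ⟨PP, PP_ne, PP_hom, PP_sqfree, ?_, ?_⟩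
  · rw [RZ_eq]
    exact Set.finite_range pt
  · rw [RZ_eq, ← Set.image_univ, Set.ncard_image_of_injective _ pt_inj, Set.ncard_univ,
      Nat.card_eq_fintype_card, Fintype.card_fin, LP_length]
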